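/- Let Σ = {ℝ_{≥0}, {0}, ℝ_{≤0}}, the set of cones of the normal fan of the segment Δ_1 = [0,1] in ℝ. For v ∈ ℝ^m define Σ_v := {(τ_1, …, τ_m) ∈ Σ^m : ∃ x ∈ ℝ such that v_i + x ∈ τ_i for all i}. Then for all v, w ∈ ℝ^m: Σ_v = Σ_w if and only if for all i, j ∈ {1, …, m}, v_i ≤ v_j ⟺ w_i ≤ w_j. -/

import Mathlib

/-- The set of cones of the normal fan of the segment `Δ_1 = [0,1] ⊆ ℝ`:
`ℝ_{≥0}`, `{0}`, and `ℝ_{≤0}`. -/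
def segmentFan : Set (Set ℝ) := {Set.Ici 0, {0}, Set.Iic 0}

/-- For `v = (v_1,…,v_m) ∈ ℝ^m`, the set `Σ_v` of tuples `(τ_1,…,τ_m)` of cones of the
normal fan of `Δ_1` such that `v_i + x ∈ τ_i` for all `i`, for some `x ∈ ℝ`. -/
def sigmaTuples (m : ℕ) (v : Fin m → ℝ) : Set (Fin m → Set ℝ) :=
  {τ | (∀ i, τ i ∈ segmentFan) ∧ ∃ x : ℝ, ∀ i, v i + x ∈ τ i}

/-- Finitely many lower bounds and upper bounds on a real number are simultaneously satisfiable
as soon as they are pairwise compatible. -/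
theorem exists_between_of_finite {s t : Set ℝ} (hs : s.Finite) (ht : t.Finite)
    (h : ∀ a ∈ s, ∀ b ∈ t, a ≤ b) : ∃ c, (∀ a ∈ s, a ≤ c) ∧ ∀ b ∈ t, c ≤ b := by
  rcases s.eq_empty_or_nonempty with rfl | hne
  · obtain ⟨c, hc⟩ := ht.bddBelow
    exact ⟨c, by simp, fun b hb => hc hb⟩
  · exact ⟨sSup s, fun a ha => le_csSup hs.bddAbove ha,
      fun b hb => csSup_le hne fun a ha => h a ha b hb⟩

/-- A cone of the fan is the intersection of the half-lines of the fan that contain it. -/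
theorem mem_of_mem_segmentFan {τ : Set ℝ} (hτ : τ ∈ segmentFan) {a : ℝ}
    (h₁ : τ ⊆ Set.Ici 0 → 0 ≤ a) (h₂ : τ ⊆ Set.Iic 0 → a ≤ 0) : a ∈ τ := by
  rcases hτ with rfl | rfl | rfl
  · exact h₁ subset_rfl
  · exact le_antisymm (h₂ (by simp)) (h₁ (by simp))
  · exact h₂ subset_rfl

theorem sigmaTuples_subset_of_le_imp_le {m : ℕ} {v w : Fin m → ℝ}
    (h : ∀ i j, v i ≤ v j → w i ≤ w j) : sigmaTuples m v ⊆ sigmaTuples m w := by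
  rintro τ ⟨hτ, x, hx⟩
  obtain ⟨c, hc₁, hc₂⟩ := exists_between_of_finite
    (s := w '' {i | τ i ⊆ Set.Iic 0}) (t := w '' {i | τ i ⊆ Set.Ici 0})
    (Set.toFinite _) (Set.toFinite _) (by
      rintro _ ⟨i, hi, rfl⟩ _ ⟨j, hj, rfl⟩
      have h₁ : v i + x ≤ 0 := hi (hx i)
      have h₂ : 0 ≤ v j + x := hj (hx j)
      exact h i j (by linarith))
  refine ⟨hτ, -c, fun i => mem_of_mem_segmentFan (hτ i) (fun hi => ?_) fun hi => ?_⟩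
  · linarith [hc₂ _ ⟨i, hi, rfl⟩]
  · linarith [hc₁ _ ⟨i, hi, rfl⟩]

theorem le_of_sigmaTuples_subset {m : ℕ} {v w : Fin m → ℝ}
    (h : sigmaTuples m v ⊆ sigmaTuples m w) {i j : Fin m} (hij : v i ≤ v j) : w i ≤ w j := by
  classical
  rcases eq_or_ne j i with rfl | hne
  · exact le_rfl
  let τ : Fin m → Set ℝ := fun k =>
    if k = i then Set.Iic 0 else if v i ≤ v k then Set.Ici 0 else Set.Iic 0
  have hτ : τ ∈ sigmaTuples m v := by
    refine ⟨fun k => ?_, -v i, fun k => ?_⟩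
    · dsimp only [τ]
      split_ifs <;> simp [segmentFan]
    · dsimp only [τ]
      split_ifs with h₁ h₂
      · simp [h₁]
      · simpa using h₂
      · simpa using (not_le.mp h₂).le
  obtain ⟨-, y, hy⟩ := h hτ
  have hi : w i + y ≤ 0 := by simpa [τ] using hy i
  have hj : 0 ≤ w j + y := by simpa [τ, hne, hij] using hy j
  linarith

/-- For `P = Δ_1`: `Σ_v = Σ_w` iff `v` and `w` induce the same weak ordering of the
coordinates, i.e. `v_i ≤ v_j ⟺ w_i ≤ w_j` for all `i, j`. -/
theorem stmt_7 (m : ℕ) (hm : 1 ≤ m) (v w : Fin m → ℝ) :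
    sigmaTuples m v = sigmaTuples m w ↔
      ∀ i j : Fin m, (v i ≤ v j ↔ w i ≤ w j) := by
  refine ⟨fun h i j => ⟨le_of_sigmaTuples_subset h.subset, le_of_sigmaTuples_subset h.superset⟩,
    fun h => Set.Subset.antisymm ?_ ?_⟩
  · exact sigmaTuples_subset_of_le_imp_le fun i j => (h i j).mp
  · exact sigmaTuples_subset_of_le_imp_le fun i j => (h i j).mpr
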